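/- arXiv:1101.0172 — 2 statements merged into one kernel-verified Lean document; each statement's English description precedes it below -/
import Mathlib

section
/- Let u be a locally bounded real-valued function on [0,T]×ℝᵈ. If u ≤ M u pointwise on [0,T]×ℝᵈ, then u* ≤ M u* pointwise on [0,T]×ℝᵈ. -/
open Filter Topology Metric Set

noncomputable section

abbrev Euc (n : ℕ) : Type := EuclideanSpace ℝ (Fin n)

/-- Lower semicontinuous envelope of `u`, taken within the set `D`. -/
noncomputable def lscEnv {α : Type*} [TopologicalSpace α] (D : Set α) (u : α → ℝ) (y : α) : ℝ :=
  Filter.liminf u (nhdsWithin y D)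

/-- Upper semicontinuous envelope of `u`, taken within the set `D`. -/
noncomputable def uscEnv {α : Type*} [TopologicalSpace α] (D : Set α) (u : α → ℝ) (y : α) : ℝ :=
  Filter.limsup u (nhdsWithin y D)

/-- The intervention operator
`M u (t,x) = sup { u (t, Γ(t,x,ζ)) + K(t,x,ζ) : ζ ∈ Z(t,x) }`. -/
noncomputable def Mop {d : ℕ} (Γ : (ℝ × Euc d) → Euc d → Euc d)
    (K : (ℝ × Euc d) → Euc d → ℝ) (Z : (ℝ × Euc d) → Set (Euc d))
    (u : ℝ × Euc d → ℝ) (y : ℝ × Euc d) : ℝ :=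
  sSup ((fun ζ => u (y.1, Γ y ζ) + K y ζ) '' Z y)

theorem isBoundedUnder_nhdsWithin_of_locally_bounded {α : Type*} [TopologicalSpace α] {D : Set α}
    {u : α → ℝ} {y : α} (h : ∃ U ∈ 𝓝 y, ∃ C : ℝ, ∀ z ∈ U ∩ D, |u z| ≤ C) :
    IsBoundedUnder (· ≤ ·) (𝓝[D] y) u ∧ IsBoundedUnder (· ≥ ·) (𝓝[D] y) u := by
  obtain ⟨U, hU, C, hC⟩ := h
  have hmem : U ∩ D ∈ 𝓝[D] y := by
    rw [inter_comm]; exact inter_mem_nhdsWithin D hU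
  exact ⟨⟨C, eventually_map.2 (mem_of_superset hmem fun z hz => (abs_le.1 (hC z hz)).2)⟩,
    ⟨-C, eventually_map.2 (mem_of_superset hmem fun z hz => (abs_le.1 (hC z hz)).1)⟩⟩

theorem uscEnv_le_of_eventually_le {α : Type*} [TopologicalSpace α] {D : Set α}
    {u : α → ℝ} {y : α} (hy : y ∈ D) (h : ∃ U ∈ 𝓝 y, ∃ C : ℝ, ∀ z ∈ U ∩ D, |u z| ≤ C) {c : ℝ}
    (hc : ∀ᶠ z in 𝓝[D] y, u z ≤ c) : uscEnv D u y ≤ c := by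
  have : (𝓝[D] y).NeBot := mem_closure_iff_nhdsWithin_neBot.1 (subset_closure hy)
  exact limsup_le_of_le (isBoundedUnder_nhdsWithin_of_locally_bounded h).2.isCoboundedUnder_le hc

theorem eventually_lt_of_uscEnv_lt {α : Type*} [TopologicalSpace α] {D : Set α}
    {u : α → ℝ} {y : α} (h : ∃ U ∈ 𝓝 y, ∃ C : ℝ, ∀ z ∈ U ∩ D, |u z| ≤ C) {c : ℝ}
    (hc : uscEnv D u y < c) : ∀ᶠ z in 𝓝[D] y, u z < c :=
  eventually_lt_of_limsup_lt hc (isBoundedUnder_nhdsWithin_of_locally_bounded h).1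

/-- The upper semicontinuous envelope is upper semicontinuous on `D`. -/
theorem eventually_uscEnv_le_of_uscEnv_lt {α : Type*} [TopologicalSpace α] {D : Set α}
    {u : α → ℝ} (h : ∀ y ∈ D, ∃ U ∈ 𝓝 y, ∃ C : ℝ, ∀ z ∈ U ∩ D, |u z| ≤ C) {y : α} (hy : y ∈ D)
    {c : ℝ} (hc : uscEnv D u y < c) : ∀ᶠ z in 𝓝[D] y, uscEnv D u z ≤ c := by
  have h1 := eventually_eventually_nhdsWithin.2 (eventually_lt_of_uscEnv_lt (h y hy) hc)
  filter_upwards [h1, self_mem_nhdsWithin] with z hz hzD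
  exact uscEnv_le_of_eventually_le hzD (h z hzD) (hz.mono fun _ => le_of_lt)

/-- Sequential Hausdorff continuity gives upper hemicontinuity. -/
theorem eventually_subset_thickening_of_seq_hausdorffDist {α β : Type*} [TopologicalSpace α]
    [FirstCountableTopology α] [PseudoMetricSpace β] {D : Set α} {Z : α → Set β}
    (hZne : ∀ y ∈ D, (Z y).Nonempty) (hZcp : ∀ y ∈ D, IsCompact (Z y)) {y : α} (hy : y ∈ D)
    (hZ : ∀ p : ℕ → α, (∀ n, p n ∈ D) → Tendsto p atTop (𝓝 y) →
      Tendsto (fun n => hausdorffDist (Z (p n)) (Z y)) atTop (𝓝 (0 : ℝ)))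
    {ε : ℝ} (hε : 0 < ε) : ∀ᶠ z in 𝓝[D] y, Z z ⊆ thickening ε (Z y) := by
  have hd : ∀ᶠ z in 𝓝[D] y, hausdorffDist (Z z) (Z y) < ε := by
    by_contra hcon
    obtain ⟨p, hp, hpD⟩ := exists_seq_forall_of_frequently
      ((not_eventually.1 hcon).and_eventually (self_mem_nhdsWithin (s := D)))
    obtain ⟨n, hn⟩ := ((hZ p (fun n => (hpD n).2)
      (tendsto_nhds_of_tendsto_nhdsWithin hp)).eventually_lt_const hε).exists
    exact (hpD n).1 hn
  filter_upwards [hd, self_mem_nhdsWithin] with z hz hzD ζ hζ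
  exact mem_thickening_iff.2 (exists_dist_lt_of_hausdorffDist_lt hζ hz
    (hausdorffEDist_ne_top_of_nonempty_of_bounded (hZne z hzD) (hZne y hy)
      (hZcp z hzD).isBounded (hZcp y hy).isBounded))

/-- For `u` locally bounded on `[0,T] × ℝᵈ`, if `u ≤ M u` pointwise on
`[0,T] × ℝᵈ`, then `u* ≤ M u*` pointwise on `[0,T] × ℝᵈ`. -/
theorem stmt2 {d : ℕ} (hd : 1 ≤ d) {T : ℝ} (hT : 0 < T)
    (Γ : (ℝ × Euc d) → Euc d → Euc d) (K : (ℝ × Euc d) → Euc d → ℝ)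
    (Z : (ℝ × Euc d) → Set (Euc d))
    (D : Set (ℝ × Euc d)) (hD : D = Set.Icc (0:ℝ) T ×ˢ (Set.univ : Set (Euc d)))
    (hΓ : ContinuousOn (fun p : (ℝ × Euc d) × Euc d => Γ p.1 p.2) (D ×ˢ (Set.univ : Set (Euc d))))
    (hK : ContinuousOn (fun p : (ℝ × Euc d) × Euc d => K p.1 p.2) (D ×ˢ (Set.univ : Set (Euc d))))
    (hZne : ∀ y ∈ D, (Z y).Nonempty)
    (hZcp : ∀ y ∈ D, IsCompact (Z y))
    (hZH : ∀ (p : ℕ → ℝ × Euc d) (q : ℝ × Euc d), (∀ n, p n ∈ D) → q ∈ D →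
      Filter.Tendsto p Filter.atTop (𝓝 q) →
      Filter.Tendsto (fun n => Metric.hausdorffDist (Z (p n)) (Z q)) Filter.atTop (𝓝 (0:ℝ)))
    (u : ℝ × Euc d → ℝ)
    (hu : ∀ y ∈ D, ∃ U ∈ 𝓝 y, ∃ C : ℝ, ∀ z ∈ U ∩ D, |u z| ≤ C)
    (hle : ∀ y ∈ D, u y ≤ Mop Γ K Z u y) :
    ∀ y ∈ D, uscEnv D u y ≤ Mop Γ K Z (uscEnv D u) y := by
  intro y hy
  have hmemD : ∀ z ∈ D, ∀ x : Euc d, (z.1, x) ∈ D := by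
    subst hD
    exact fun z hz x => ⟨hz.1, mem_univ _⟩
  have hnhds : ∀ ζ : Euc d, 𝓝[D ×ˢ (univ : Set (Euc d))] (y, ζ) = 𝓝[D] y ×ˢ 𝓝 ζ := fun ζ => by
    rw [nhdsWithin_prod_eq, nhdsWithin_univ]
  have hΓt : ∀ ζ : Euc d, Tendsto (fun p : (ℝ × Euc d) × Euc d => (p.1.1, Γ p.1 p.2))
      (𝓝[D] y ×ˢ 𝓝 ζ) (𝓝[D] (y.1, Γ y ζ)) := fun ζ => by
    have hg := hΓ (y, ζ) ⟨hy, mem_univ _⟩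
    rw [ContinuousWithinAt, hnhds] at hg
    refine tendsto_nhdsWithin_iff.2 ⟨Tendsto.prodMk_nhds ?_ hg, ?_⟩
    · exact (continuous_fst.tendsto y).comp
        ((tendsto_nhds_of_tendsto_nhdsWithin tendsto_id).comp tendsto_fst)
    · exact (tendsto_fst.eventually self_mem_nhdsWithin).mono fun p hp => hmemD _ hp _
  have hKt : ∀ ζ : Euc d, Tendsto (fun p : (ℝ × Euc d) × Euc d => K p.1 p.2)
      (𝓝[D] y ×ˢ 𝓝 ζ) (𝓝 (K y ζ)) := fun ζ => by
    have hg := hK (y, ζ) ⟨hy, mem_univ _⟩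
    rwa [ContinuousWithinAt, hnhds] at hg
  have hbdd : BddAbove ((fun ζ => uscEnv D u (y.1, Γ y ζ) + K y ζ) '' Z y) := by
    refine (hZcp y hy).induction_on (p := fun s =>
      BddAbove ((fun ζ => uscEnv D u (y.1, Γ y ζ) + K y ζ) '' s)) (by simp)
      (fun s t hst ht => ht.mono (image_mono hst))
      (fun s t hs ht => by rw [image_union]; exact hs.union ht) fun ζ _ => ?_
    have hsec : Tendsto (fun ζ' : Euc d => (y, ζ')) (𝓝 ζ) (𝓝[D] y ×ˢ 𝓝 ζ) :=
      (tendsto_const_nhdsWithin hy).prodMk tendsto_id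
    have h1 := ((hΓt ζ).comp hsec).eventually (eventually_uscEnv_le_of_uscEnv_lt hu
      (hmemD y hy (Γ y ζ)) (lt_add_one _))
    have h2 := ((hKt ζ).comp hsec).eventually_lt_const (lt_add_one _)
    refine ⟨_, mem_nhdsWithin_of_mem_nhds (h1.and h2),
      uscEnv D u (y.1, Γ y ζ) + 1 + (K y ζ + 1), ?_⟩
    rintro _ ⟨ζ', ⟨h1', h2'⟩, rfl⟩
    exact add_le_add h1' h2'.le
  refine le_of_forall_gt_imp_ge_of_dense fun c hc => ?_
  have hloc : ∀ ζ ∈ Z y, {p : (ℝ × Euc d) × Euc d | u (p.1.1, Γ p.1 p.2) + K p.1 p.2 < c} ∈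
      𝓝[D] y ×ˢ 𝓝 ζ := fun ζ hζ => by
    have hlt : uscEnv D u (y.1, Γ y ζ) + K y ζ < c :=
      (le_csSup hbdd (mem_image_of_mem _ hζ)).trans_lt hc
    obtain ⟨a, ha, ha'⟩ := exists_between (lt_sub_iff_add_lt.2 hlt)
    have h1 := (hΓt ζ).eventually (eventually_lt_of_uscEnv_lt (hu _ (hmemD y hy (Γ y ζ))) ha)
    have h2 := (hKt ζ).eventually_lt_const (show K y ζ < c - a by linarith)
    filter_upwards [h1, h2] with p hp1 hp2
    linarith
  have htube := (hZcp y hy).mem_prod_nhdsSet_of_forall hloc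
  obtain ⟨N, hN, V, hV, hNV⟩ := mem_prod_iff.1 htube
  obtain ⟨ε, hε, hεV⟩ := ((hZcp y hy).exists_thickening_subset_open isOpen_interior
    (subset_interior_iff_mem_nhdsSet.2 hV))
  refine uscEnv_le_of_eventually_le hy (hu y hy) ?_
  filter_upwards [hN, self_mem_nhdsWithin, eventually_subset_thickening_of_seq_hausdorffDist
    hZne hZcp hy (fun p hp => hZH p y hp hy) hε] with z hzN hzD hzZ
  refine (hle z hzD).trans (csSup_le ((hZne z hzD).image _) ?_)
  rintro _ ⟨ζ, hζ, rfl⟩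
  have hmem : (z, ζ) ∈ N ×ˢ V := ⟨hzN, interior_subset (hεV (hzZ hζ))⟩
  exact le_of_lt (hNV hmem)
end
end

section
/- Fix δ ∈ (0,1). Let β_k → β in B, x_k → x in ℝᵈ, p_k → p in ℝᵈ, and let v ∈ PB be lower semicontinuous with v(x_k) → v(x). Then liminf_{k→∞} I^{2,δ}_{β_k}[x_k, p_k, v] ≥ I^{2,δ}_β[x, p, v]. -/
open Filter Topology Metric Set MeasureTheory
open scoped RealInnerProductSpace ENNReal

noncomputable section

/-- Membership in the space `PB` of measurable, polynomially bounded functions of order `b`. -/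
def PB {d : ℕ} (b : ℝ) (u : Euc d → ℝ) : Prop :=
  Measurable u ∧ ∃ C : ℝ, ∀ y : Euc d, |u y| ≤ C * (1 + ‖y‖ ^ b)

/-- The nonlocal operator
`I^{2,δ}_β[x,p,u] = ∫_{|z|≥δ} [u(x+ℓ(x,β,z)) − u(x) − ⟨p, ℓ(x,β,z)⟩·1_{|z|<1}] ν(dz)`. -/
noncomputable def I2 {d k : ℕ} {B : Type*} (ν : Measure (Euc k))
    (ℓ : Euc d → B → Euc k → Euc d) (δ : ℝ) (β : B) (x p : Euc d) (u : Euc d → ℝ) : ℝ :=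
  ∫ z in {z : Euc k | δ ≤ ‖z‖},
    (u (x + ℓ x β z) - u x - (if ‖z‖ < 1 then ⟪p, ℓ x β z⟫ else 0)) ∂ν

/-- A Fatou lemma for real-valued functions with a two-sided integrable bound. -/
theorem integral_le_liminf_of_dominated {α : Type*} [MeasurableSpace α] {μ : Measure α}
    {f : ℕ → α → ℝ} {g G : α → ℝ} (hG : Integrable G μ)
    (hf : ∀ j, AEStronglyMeasurable (f j) μ) (hg : AEStronglyMeasurable g μ)
    (hfG : ∀ᶠ j in atTop, ∀ᵐ z ∂μ, |f j z| ≤ G z) (hgG : ∀ᵐ z ∂μ, |g z| ≤ G z)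
    (h : ∀ᵐ z ∂μ, ∀ c < g z, ∀ᶠ j in atTop, c < f j z) :
    ∫ z, g z ∂μ ≤ liminf (fun j => ∫ z, f j z ∂μ) atTop := by
  have hmin : Tendsto (fun j => ∫ z, min (f j z) (g z) ∂μ) atTop (𝓝 (∫ z, g z ∂μ)) := by
    refine tendsto_integral_filter_of_dominated_convergence G
      (Eventually.of_forall fun j => (hf j).inf hg) ?_ hG ?_
    · filter_upwards [hfG] with j hj
      filter_upwards [hj, hgG] with z h1 h2
      rw [Real.norm_eq_abs]
      exact abs_min_le_max_abs_abs.trans (max_le h1 h2)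
    · filter_upwards [h] with z hz
      refine tendsto_order.2 ⟨fun c hc => ?_, fun c hc => Eventually.of_forall fun j =>
        (min_le_right _ _).trans_lt hc⟩
      filter_upwards [hz c hc] with j hj using lt_min hj hc
  have hle : ∀ᶠ j in atTop, ∫ z, min (f j z) (g z) ∂μ ≤ ∫ z, f j z ∂μ := by
    filter_upwards [hfG] with j hj
    have hfi : Integrable (f j) μ := hG.mono' (hf j) hj
    have hgi : Integrable g μ := hG.mono' hg hgG
    exact integral_mono (hfi.inf hgi) hfi fun z => min_le_left _ _
  have hup : ∀ᶠ j in atTop, ∫ z, f j z ∂μ ≤ ∫ z, G z ∂μ := by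
    filter_upwards [hfG] with j hj
    refine integral_mono_ae (hG.mono' (hf j) hj) hG ?_
    filter_upwards [hj] with z hz using (le_abs_self _).trans hz
  refine le_of_forall_lt_imp_le_of_dense fun c hc => ?_
  refine le_liminf_of_le (IsBoundedUnder.isCoboundedUnder_ge ⟨_, hup⟩) ?_
  filter_upwards [hmin.eventually_const_lt hc, hle] with j h1 h2 using h1.le.trans h2

/-- A Lévy measure is finite away from the origin. -/
theorem levy_measure_norm_ge_lt_top {k : ℕ} {ν : Measure (Euc k)}
    (hν : (∫⁻ z, ENNReal.ofReal (min (‖z‖ ^ 2) 1) ∂ν) ≠ ⊤) {δ : ℝ} (hδ : 0 < δ) :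
    ν {z : Euc k | δ ≤ ‖z‖} < ⊤ := by
  have hpos : 0 < min (δ ^ 2) 1 := lt_min (by positivity) one_pos
  have hmeas : AEMeasurable (fun z : Euc k => ENNReal.ofReal (min (‖z‖ ^ 2) 1)) ν := by
    fun_prop
  refine (measure_mono fun z (hz : δ ≤ ‖z‖) => ?_).trans_lt
    ((meas_ge_le_lintegral_div hmeas (ε := ENNReal.ofReal (min (δ ^ 2) 1)) ?_
      ENNReal.ofReal_ne_top).trans_lt (ENNReal.div_lt_top hν ?_))
  · change ENNReal.ofReal _ ≤ ENNReal.ofReal _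
    gcongr
  · exact (ENNReal.ofReal_pos.2 hpos).ne'
  · exact (ENNReal.ofReal_pos.2 hpos).ne'

theorem integrableOn_max_one_norm_rpow {k : ℕ} {ν : Measure (Euc k)} {r δ : ℝ}
    (hν : ν {z : Euc k | δ ≤ ‖z‖} < ⊤)
    (hνp : (∫⁻ z in {z : Euc k | 1 ≤ ‖z‖}, ENNReal.ofReal (‖z‖ ^ r) ∂ν) ≠ ⊤) :
    IntegrableOn (fun z : Euc k => max 1 ‖z‖ ^ r) {z | δ ≤ ‖z‖} ν := by
  have hfar : IntegrableOn (fun z : Euc k => ‖z‖ ^ r) {z | 1 ≤ ‖z‖} ν :=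
    (lintegral_ofReal_ne_top_iff_integrable
      (measurable_norm.pow_const r).aestronglyMeasurable (ae_of_all _ fun z => by positivity)).1 hνp
  have hS : MeasurableSet {z : Euc k | δ ≤ ‖z‖} := measurableSet_le measurable_const measurable_norm
  have hT : MeasurableSet {z : Euc k | 1 ≤ ‖z‖} := measurableSet_le measurable_const measurable_norm
  have hfar' : IntegrableOn (fun z : Euc k => max 1 ‖z‖ ^ r) {z | 1 ≤ ‖z‖} ν :=
    hfar.congr_fun (fun z (hz : 1 ≤ ‖z‖) => by simp only [max_eq_right hz]) hT
  have hnear : IntegrableOn (fun z : Euc k => max 1 ‖z‖ ^ r)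
      ({z | δ ≤ ‖z‖} ∩ {z | 1 ≤ ‖z‖}ᶜ) ν := by
    have hone : IntegrableOn (fun _ : Euc k => (1 : ℝ)) ({z | δ ≤ ‖z‖} ∩ {z | 1 ≤ ‖z‖}ᶜ) ν :=
      integrableOn_const ((measure_mono inter_subset_left).trans_lt hν).ne
    refine hone.congr_fun (fun z hz => ?_) (hS.inter hT.compl)
    have h1 : ‖z‖ ≤ 1 := le_of_not_ge fun h => hz.2 h
    simp [max_eq_left h1]
  refine (hfar'.union hnear).mono_set fun z hz => ?_
  by_cases h : 1 ≤ ‖z‖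
  · exact Or.inl h
  · exact Or.inr ⟨hz, h⟩

/-- Pointwise bound of the integrand of `I2`, in terms of bounds on its ingredients. -/
theorem abs_I2_integrand_le {d : ℕ} {u : Euc d → ℝ} {y p l : Euc d}
    {a b r A R P C m t : ℝ} (hb : 0 ≤ b) (hab : a * b ≤ r) (ha : 0 ≤ a)
    (hA : 0 ≤ A) (hR : 1 ≤ R) (hC : 0 ≤ C) (hP : 0 ≤ P)
    (hu : ∀ y, |u y| ≤ A * (1 + ‖y‖ ^ b)) (hy : ‖y‖ ≤ R) (hp : ‖p‖ ≤ P)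
    (hm : 1 ≤ m) (hmt : t < 1 → m = 1) (hl : ‖l‖ ≤ C * m ^ a) :
    |u (y + l) - u y - (if t < 1 then ⟪p, l⟫ else 0)| ≤
      (2 * (A * (1 + (R + C) ^ b)) + P * C) * m ^ r := by
  have hma : 1 ≤ m ^ a := Real.one_le_rpow hm ha
  have hmab : m ^ (a * b) ≤ m ^ r := Real.rpow_le_rpow_of_exponent_le hm hab
  have hmab1 : 1 ≤ m ^ (a * b) := Real.one_le_rpow hm (mul_nonneg ha hb)
  have hmr : 1 ≤ m ^ r := hmab1.trans hmab
  have key : ∀ w : Euc d, ‖w‖ ≤ (R + C) * m ^ a → |u w| ≤ A * (1 + (R + C) ^ b) * m ^ r := by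
    intro w hw
    have h1 : ‖w‖ ^ b ≤ (R + C) ^ b * m ^ r := by
      calc ‖w‖ ^ b ≤ ((R + C) * m ^ a) ^ b := by gcongr
        _ = (R + C) ^ b * m ^ (a * b) := by
          rw [Real.mul_rpow (by positivity) (by positivity), ← Real.rpow_mul (by positivity)]
        _ ≤ _ := by gcongr
    calc |u w| ≤ A * (1 + ‖w‖ ^ b) := hu w
      _ ≤ A * (m ^ r + (R + C) ^ b * m ^ r) := by gcongr
      _ = _ := by ring
  have h1 := key (y + l) <| by
    calc ‖y + l‖ ≤ ‖y‖ + ‖l‖ := norm_add_le _ _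
      _ ≤ R * m ^ a + C * m ^ a := by gcongr; nlinarith
      _ = _ := by ring
  have h2 := key y <| by nlinarith
  have h3 : |if t < 1 then ⟪p, l⟫ else 0| ≤ P * C * m ^ r := by
    split_ifs with ht
    · rw [hmt ht, Real.one_rpow, mul_one] at hl
      calc |⟪p, l⟫| ≤ ‖p‖ * ‖l‖ := abs_real_inner_le_norm _ _
        _ ≤ P * C := by gcongr
        _ ≤ P * C * m ^ r := le_mul_of_one_le_right (by positivity) hmr
    · rw [abs_zero]; positivity
  calc _ ≤ |u (y + l)| + |u y| + |if t < 1 then ⟪p, l⟫ else 0| :=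
        (abs_sub _ _).trans (add_le_add_left (abs_sub _ _) _)
    _ ≤ _ := by linarith

/-- for `δ ∈ (0,1)`, `β_k → β`, `x_k → x`, `p_k → p`, and `v ∈ PB` lower
semicontinuous with `v(x_k) → v(x)`:
`liminf_k I^{2,δ}_{β_k}[x_k,p_k,v] ≥ I^{2,δ}_β[x,p,v]`. -/
theorem stmt9 {d k : ℕ} (hd : 1 ≤ d) (hk : 1 ≤ k)
    {B : Type*} [MetricSpace B] [CompactSpace B] [Nonempty B]
    (ν : Measure (Euc k))
    (hν : (∫⁻ z, ENNReal.ofReal (min (‖z‖ ^ 2) 1) ∂ν) ≠ ⊤)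
    (ℓ : Euc d → B → Euc k → Euc d)
    (hℓ : Continuous (fun q : Euc d × B × Euc k => ℓ q.1 q.2.1 q.2.2))
    (a b pstar qstar : ℝ) (ha : 0 ≤ a) (hb : 0 ≤ b) (hpstar : 0 < pstar)
    (hab : a * b ≤ pstar) (hqstar : 0 ≤ qstar)
    (hνp : (∫⁻ z in {z : Euc k | 1 ≤ ‖z‖}, ENNReal.ofReal (‖z‖ ^ pstar) ∂ν) ≠ ⊤)
    (hνq : (∫⁻ z in {z : Euc k | ‖z‖ < 1}, ENNReal.ofReal (‖z‖ ^ qstar) ∂ν) ≠ ⊤)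
    (hgrowth : ∀ x : Euc d, ∃ U ∈ 𝓝 x, ∃ C : ℝ, ∀ x' ∈ U, ∀ (β : B) (z : Euc k),
      (1 ≤ ‖z‖ → ‖ℓ x' β z‖ ≤ C * (1 + ‖z‖ ^ a)) ∧
      (‖z‖ < 1 → ‖ℓ x' β z‖ ≤ C * ‖z‖ ^ (qstar / 2)))
    (δ : ℝ) (hδ : δ ∈ Set.Ioo (0:ℝ) 1)
    (βk : ℕ → B) (β : B) (hβ : Filter.Tendsto βk Filter.atTop (𝓝 β))
    (xk : ℕ → Euc d) (x : Euc d) (hx : Filter.Tendsto xk Filter.atTop (𝓝 x))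
    (pk : ℕ → Euc d) (p : Euc d) (hp : Filter.Tendsto pk Filter.atTop (𝓝 p))
    (v : Euc d → ℝ) (hv : PB b v) (hlsc : LowerSemicontinuous v)
    (hvc : Filter.Tendsto (fun j => v (xk j)) Filter.atTop (𝓝 (v x))) :
    I2 ν ℓ δ β x p v ≤
      Filter.liminf (fun j => I2 ν ℓ δ (βk j) (xk j) (pk j) v) Filter.atTop := by
  obtain ⟨hvm, A, hA⟩ := hv
  obtain ⟨U, hU, C, hC⟩ := hgrowth x
  have hA' : ∀ y, |v y| ≤ |A| * (1 + ‖y‖ ^ b) := fun y => (hA y).trans <| by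
    gcongr
    exact le_abs_self A
  have hl : ∀ x' ∈ U, ∀ β z, ‖ℓ x' β z‖ ≤ 2 * |C| * max 1 ‖z‖ ^ a := by
    intro x' hx' β z
    rcases le_or_gt 1 ‖z‖ with hz | hz
    · have h1 : 1 ≤ ‖z‖ ^ a := Real.one_le_rpow hz ha
      rw [max_eq_right hz]
      calc _ ≤ C * (1 + ‖z‖ ^ a) := (hC x' hx' β z).1 hz
        _ ≤ |C| * (‖z‖ ^ a + ‖z‖ ^ a) := by gcongr; exact le_abs_self C
        _ = _ := by ring
    · have h1 : ‖z‖ ^ (qstar / 2) ≤ 1 :=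
        Real.rpow_le_one (norm_nonneg _) hz.le (by positivity)
      rw [max_eq_left hz.le, Real.one_rpow, mul_one]
      calc _ ≤ C * ‖z‖ ^ (qstar / 2) := (hC x' hx' β z).2 hz
        _ ≤ |C| * 1 := by gcongr; exact le_abs_self C
        _ ≤ _ := by linarith [abs_nonneg C]
  have hbound : ∀ x' ∈ U, ‖x'‖ ≤ ‖x‖ + 1 → ∀ p' : Euc d, ‖p'‖ ≤ ‖p‖ + 1 → ∀ β z,
      |v (x' + ℓ x' β z) - v x' - (if ‖z‖ < 1 then ⟪p', ℓ x' β z⟫ else 0)| ≤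
      (2 * (|A| * (1 + (‖x‖ + 1 + 2 * |C|) ^ b)) + (‖p‖ + 1) * (2 * |C|)) *
        max 1 ‖z‖ ^ pstar := fun x' hx' hxn p' hp' β z =>
    abs_I2_integrand_le hb hab ha (abs_nonneg A) (by linarith [norm_nonneg x]) (by positivity)
      (by positivity) hA' hxn hp' (le_max_left _ _) (fun h => max_eq_left h.le) (hl x' hx' β z)
  have hmeas : ∀ (x' p' : Euc d) (β : B), Measurable fun z =>
      v (x' + ℓ x' β z) - v x' - (if ‖z‖ < 1 then ⟪p', ℓ x' β z⟫ else 0) := by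
    intro x' p' β
    have hc : Continuous (ℓ x' β) :=
      hℓ.comp (continuous_const.prodMk (continuous_const.prodMk continuous_id))
    refine ((hvm.comp (continuous_const.add hc).measurable).sub_const _).sub ?_
    exact Measurable.ite (measurableSet_lt measurable_norm measurable_const)
      (continuous_const.inner hc).measurable measurable_const
  refine integral_le_liminf_of_dominated
    ((integrableOn_max_one_norm_rpow (levy_measure_norm_ge_lt_top hν hδ.1) hνp).const_mul
      (2 * (|A| * (1 + (‖x‖ + 1 + 2 * |C|) ^ b)) + (‖p‖ + 1) * (2 * |C|)))
    (fun j => (hmeas _ _ _).aestronglyMeasurable) (hmeas _ _ _).aestronglyMeasurable ?_ ?_ ?_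
  · filter_upwards [hx hU, hx.norm.eventually_le_const (lt_add_one _),
      hp.norm.eventually_le_const (lt_add_one _)] with j h1 h2 h3
    exact ae_of_all _ (hbound _ h1 h2 _ h3 _)
  · exact ae_of_all _
      (hbound x (mem_of_mem_nhds hU) (lt_add_one _).le p (lt_add_one _).le β)
  · refine ae_of_all _ fun z c hc => ?_
    have hℓz : Tendsto (fun j => ℓ (xk j) (βk j) z) atTop (𝓝 (ℓ x β z)) :=
      (hℓ.tendsto (x, β, z)).comp (hx.prodMk_nhds (hβ.prodMk_nhds tendsto_const_nhds))
    have hw : Tendsto (fun j => v (xk j) + if ‖z‖ < 1 then ⟪pk j, ℓ (xk j) (βk j) z⟫ else 0)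
        atTop (𝓝 (v x + if ‖z‖ < 1 then ⟪p, ℓ x β z⟫ else 0)) := by
      refine hvc.add ?_
      split_ifs
      · exact hp.inner hℓz
      · exact tendsto_const_nhds
    obtain ⟨m, hm1, hm2⟩ : ∃ m, c + (v x + if ‖z‖ < 1 then ⟪p, ℓ x β z⟫ else 0) < m ∧
        m < v (x + ℓ x β z) := exists_between (by linarith)
    filter_upwards [(hx.add hℓz).eventually (hlsc _ m hm2),
      (hw.const_add c).eventually_lt_const hm1] with j h1 h2
    linarith
end
end
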